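/- Suppose a user has n⁺ positive items and n⁻ negative items with pairwise distinct scores, and let K be an integer with K < n⁺ and K < n⁻. Then Precision@K ≤ (1/K)·⌈√(n⁺·n⁻·LLPAUC(K/n⁺, K/n⁻))⌉, where ⌈·⌉ is the ceiling function and √ is the real square root. -/

import Mathlib

open Finset

open scoped Classical

noncomputable section

/-- The `K` highest-scoring items under the score function `f`: those items
with fewer than `K` items scoring strictly higher (with pairwise distinct
scores these are exactly the top `K` items, provided `K ≤ card`). -/
def topK {α : Type*} [Fintype α] (K : ℕ) (f : α → ℝ) : Finset α :=
  Finset.univ.filter fun a => (Finset.univ.filter fun b => f a < f b).card < K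

/-- Empirical LLPAUC at `(α, β) = (K/n⁺, K/n⁻)`: the fraction (over all
`n⁺ · n⁻` pairs) of pairs `(i, j)` where `i` is one of the `K` highest-scoring
positive items, `j` is one of the `K` highest-scoring negative items, and
`i`'s score exceeds `j`'s score. -/
def llpauc (np nn K : ℕ) (p : Fin np → ℝ) (q : Fin nn → ℝ) : ℝ :=
  (((topK K p ×ˢ topK K q).filter fun ij => q ij.2 < p ij.1).card : ℝ) /
    ((np : ℝ) * (nn : ℝ))

/-- Empirical OPAUC at `β = K/n⁻`: the fraction (over all `n⁺ · n⁻` pairs) of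
pairs `(i, j)` where `i` is any positive item, `j` is one of the `K`
highest-scoring negative items, and `i`'s score exceeds `j`'s score. -/
def opauc (np nn K : ℕ) (p : Fin np → ℝ) (q : Fin nn → ℝ) : ℝ :=
  (((Finset.univ ×ˢ topK K q).filter fun ij : Fin np × Fin nn =>
      q ij.2 < p ij.1).card : ℝ) / ((np : ℝ) * (nn : ℝ))

/-- The number of positive items among the `K` highest-scoring items overall
(positives scored by `p`, negatives scored by `q`). -/
def hitNum (np nn K : ℕ) (p : Fin np → ℝ) (q : Fin nn → ℝ) : ℕ :=
  (Finset.univ.filter fun i : Fin np =>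
    (Finset.univ.filter fun x : Fin np ⊕ Fin nn =>
      p i < Sum.elim p q x).card < K).card

/-- Recall@K: the number of positive items among the `K` highest-scoring items
overall, divided by the number `n⁺` of positive items. -/
def recallK (np nn K : ℕ) (p : Fin np → ℝ) (q : Fin nn → ℝ) : ℝ :=
  (hitNum np nn K p q : ℝ) / (np : ℝ)

/-- Precision@K: the number of positive items among the `K` highest-scoring
items overall, divided by `K`. -/
def precisionK (np nn K : ℕ) (p : Fin np → ℝ) (q : Fin nn → ℝ) : ℝ :=
  (hitNum np nn K p q : ℝ) / (K : ℝ)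

theorem card_filter_lt_injective {α : Type*} [Fintype α] {f : α → ℝ}
    (hf : Function.Injective f) :
    Function.Injective fun a => (Finset.univ.filter fun b => f a < f b).card := by
  have key : ∀ a b, f a < f b → (Finset.univ.filter fun c => f b < f c).card <
      (Finset.univ.filter fun c => f a < f c).card := by
    intro a b hab
    apply Finset.card_lt_card
    rw [Finset.ssubset_iff_of_subset]
    · exact ⟨b, by simpa using hab, by simp⟩
    · intro c hc
      simp only [Finset.mem_filter, Finset.mem_univ, true_and] at hc ⊢
      exact hab.trans hc
  intro a b hab
  rcases lt_trichotomy (f a) (f b) with h | h | h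
  · exact absurd hab (key a b h).ne'
  · exact hf h
  · exact absurd hab (key b a h).ne

theorem card_topK {α : Type*} [Fintype α] {f : α → ℝ} (hf : Function.Injective f)
    {K : ℕ} (hK : K ≤ Fintype.card α) : (topK K f).card = K := by
  set r : α → ℕ := fun a => (Finset.univ.filter fun b => f a < f b).card
  have hinj : Function.Injective r := card_filter_lt_injective hf
  have himage : Finset.univ.image r = Finset.range (Fintype.card α) := by
    apply Finset.eq_of_subset_of_card_le
    · intro k hk
      obtain ⟨a, -, rfl⟩ := Finset.mem_image.mp hk
      rw [Finset.mem_range]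
      exact Finset.card_lt_univ_of_notMem (x := a) (by simp)
    · rw [Finset.card_image_of_injective _ hinj, Finset.card_range, Finset.card_univ]
  have htop : (topK K f).image r = Finset.range K := by
    ext k
    simp only [Finset.mem_image, Finset.mem_range, topK, Finset.mem_filter,
      Finset.mem_univ, true_and]
    constructor
    · rintro ⟨a, ha, rfl⟩
      exact ha
    · intro hk
      have hmem : k ∈ Finset.univ.image r := by
        rw [himage, Finset.mem_range]
        exact hk.trans_le hK
      obtain ⟨a, -, rfl⟩ := Finset.mem_image.mp hmem
      exact ⟨a, hk, rfl⟩
  rw [← Finset.card_image_of_injective _ hinj, htop, Finset.card_range]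

theorem mem_topK_of_le {α : Type*} [Fintype α] {f : α → ℝ} {K : ℕ} {a b : α}
    (ha : a ∈ topK K f) (hab : f a ≤ f b) : b ∈ topK K f := by
  simp only [topK, Finset.mem_filter, Finset.mem_univ, true_and] at ha ⊢
  refine (Finset.card_le_card fun c hc => ?_).trans_lt ha
  simp only [Finset.mem_filter, Finset.mem_univ, true_and] at hc ⊢
  exact hab.trans_lt hc

theorem mem_topK_comp {α β : Type*} [Fintype α] [Fintype β] {f : β → ℝ} {K : ℕ}
    {g : α → β} (hg : Function.Injective g) {a : α} (ha : g a ∈ topK K f) :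
    a ∈ topK K (f ∘ g) := by
  simp only [topK, Finset.mem_filter, Finset.mem_univ, true_and] at ha ⊢
  refine (Finset.card_le_card_of_injOn g (fun c hc => ?_) hg.injOn).trans_lt ha
  simpa using hc

theorem hitNum_sq_le_card (np nn K : ℕ) (p : Fin np → ℝ) (q : Fin nn → ℝ)
    (hinj : Function.Injective (Sum.elim p q)) (hKn : K ≤ nn) :
    hitNum np nn K p q ^ 2 ≤
      ((topK K p ×ˢ topK K q).filter fun ij => q ij.2 < p ij.1).card := by
  obtain ⟨T, hT⟩ : ∃ T, T = topK K (Sum.elim p q) := ⟨_, rfl⟩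
  have hhit : hitNum np nn K p q = T.toLeft.card := by
    unfold hitNum
    congr 1
    ext i
    simp only [hT, topK, Finset.mem_toLeft, Finset.mem_filter, Finset.mem_univ, true_and,
      Sum.elim_inl]
    congr!
  have hcardT : T.toLeft.card + T.toRight.card = K := by
    rw [Finset.card_toLeft_add_card_toRight, hT]
    exact card_topK hinj (by simp only [Fintype.card_sum, Fintype.card_fin]; omega)
  have hcardq : (topK K q).card = K :=
    card_topK (fun a b h => Sum.inr_injective (hinj h)) (by simpa using hKn)
  have hmiss : T.toLeft.card ≤ (topK K q \ T.toRight).card := by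
    have := Finset.le_card_sdiff T.toRight (topK K q)
    omega
  rw [hhit, sq]
  refine (Nat.mul_le_mul_left _ hmiss).trans ?_
  rw [← Finset.card_product]
  apply Finset.card_le_card
  rintro ⟨i, j⟩ hij
  simp only [Finset.mem_product, Finset.mem_sdiff, Finset.mem_toLeft,
    Finset.mem_toRight] at hij
  obtain ⟨hi, hj, hjT⟩ := hij
  simp only [Finset.mem_filter, Finset.mem_product]
  rw [hT] at hi hjT
  have hip : i ∈ topK K p := mem_topK_comp (f := Sum.elim p q) Sum.inl_injective hi
  refine ⟨⟨hip, hj⟩, not_le.mp fun h => hjT ?_⟩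
  exact mem_topK_of_le (a := Sum.inl i) (b := Sum.inr j) hi h

/-- with pairwise distinct scores and `K < n⁺`, `K < n⁻`,
`Precision@K ≤ (1/K)·⌈√(n⁺·n⁻·LLPAUC(K/n⁺, K/n⁻))⌉`. -/
theorem precision_le_llpauc_ceil_bound (np nn K : ℕ) (p : Fin np → ℝ) (q : Fin nn → ℝ)
    (hinj : Function.Injective (Sum.elim p q)) (hKp : K < np) (hKn : K < nn) :
    precisionK np nn K p q ≤
      (1 / (K : ℝ)) *
        ((⌈Real.sqrt ((np : ℝ) * (nn : ℝ) * llpauc np nn K p q)⌉ : ℤ) : ℝ) := by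
  have hpos : (np : ℝ) * (nn : ℝ) ≠ 0 := by
    have h₁ : np ≠ 0 := by omega
    have h₂ : nn ≠ 0 := by omega
    positivity
  rw [precisionK, llpauc, mul_div_cancel₀ _ hpos, div_eq_mul_one_div, mul_comm]
  refine mul_le_mul_of_nonneg_left (le_trans ?_ (Int.le_ceil _)) (by positivity)
  apply Real.le_sqrt_of_sq_le
  exact_mod_cast hitNum_sq_le_card np nn K p q hinj hKn.le
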